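/- Multiplicativity of iterated integrals under composition of 1-paths: if γ and δ are 1-paths in U with γ(1) = δ(0), then for every k ≥ 1 and all smooth maps ω₁,…,ω_k : U → (E →L[ℝ] A), ⟨ω₁⋯ω_k, γ∘δ⟩ = Σ_{i=0}^{k} ⟨ω₁⋯ωᵢ, γ⟩ · ⟨ω_{i+1}⋯ω_k, δ⟩. (This is the homogeneous-component form of the identity ⟨T_ω, γ∘δ⟩ = ⟨T_ω, γ⟩·⟨T_ω, δ⟩ for the transport of a formal power series connection.) -/

import Mathlib

open MeasureTheory

variable {E : Type*} [NormedAddCommGroup E] [NormedSpace ℝ E] [FiniteDimensional ℝ E]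
variable {A : Type*} [NormedRing A] [NormedAlgebra ℝ A] [CompleteSpace A]

/-- A 1-path in `U ⊆ E`: a smooth map `γ : ℝ → E` with values in `U` that is constant
on `(-∞, ε]` and on `[1 - ε, ∞)` for some `ε > 0`. -/
def IsPathIn (U : Set E) (γ : ℝ → E) : Prop :=
  ContDiff ℝ (⊤ : ℕ∞) γ ∧ (∀ t, γ t ∈ U) ∧
    ∃ ε > (0 : ℝ), (∀ t ≤ ε, γ t = γ 0) ∧ (∀ t, 1 - ε ≤ t → γ t = γ 1)

/-- A rank-1 homotopy in `U`: a smooth map `h : ℝ × ℝ → E` with values in `U`, constant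
in `t` near `t = 0` and `t = 1`, whose images at `t = 0` and `t = 1` are single points,
and whose Fréchet derivative has rank at most 1 at every point. -/
def IsRank1HomotopyIn (U : Set E) (h : ℝ × ℝ → E) : Prop :=
  ContDiff ℝ (⊤ : ℕ∞) h ∧ (∀ p, h p ∈ U) ∧
    (∃ ε > (0 : ℝ),
      (∀ s t, t ≤ ε → h (s, t) = h (s, 0)) ∧
      (∀ s t, 1 - ε ≤ t → h (s, t) = h (s, 1))) ∧
    (∀ s s', h (s, 0) = h (s', 0)) ∧ (∀ s s', h (s, 1) = h (s', 1)) ∧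
    ∀ p : ℝ × ℝ,
      Module.finrank ℝ (LinearMap.range (fderiv ℝ h p).toLinearMap) ≤ 1

/-- Two 1-paths in `U` are rank-1 homotopic if they are joined by a rank-1 homotopy
in `U`. -/
def Rank1HomotopicIn (U : Set E) (γ δ : ℝ → E) : Prop :=
  ∃ h : ℝ × ℝ → E, IsRank1HomotopyIn U h ∧
    (∀ t, h (0, t) = γ t) ∧ (∀ t, h (1, t) = δ t)

/-- The simplex `{t : ℝᵏ | 0 ≤ t 0 ≤ ⋯ ≤ t (k-1) ≤ 1}`. -/
def unitSimplexSet (k : ℕ) : Set (Fin k → ℝ) :=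
  {t | Monotone t ∧ ∀ i, t i ∈ Set.Icc (0 : ℝ) 1}

/-- The iterated integral `⟨ω₁ ⋯ ω_k, γ⟩` of a list `ω = [ω₁, …, ω_k]` of `A`-valued
1-forms on `E` along a 1-path `γ`: the Bochner integral of the ordered product
`ω₁ (γ t₁) (γ' t₁) ⋯ ω_k (γ t_k) (γ' t_k)` over the simplex `0 ≤ t₁ ≤ ⋯ ≤ t_k ≤ 1`.
For `k = 0` it equals `1`. -/
noncomputable def pathIterInt (ω : List (E → (E →L[ℝ] A))) (γ : ℝ → E) : A :=
  ∫ t in unitSimplexSet ω.length,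
    (List.ofFn fun i => ω.get i (γ (t i)) (deriv γ (t i))).prod

/-- Composition of 1-paths. -/
noncomputable def compPath (γ δ : ℝ → E) : ℝ → E := fun t =>
  if t ≤ 1 / 2 then γ (2 * t) else δ (2 * t - 1)

/-- Recursive iterated integral. -/
noncomputable def recInt {ι : Type*} (F : ι → ℝ → A) : List ι → ℝ → ℝ → A
  | [], _, _ => 1
  | i :: L, a, b => ∫ t in a..b, F i t * recInt F L t b

/-- The simplex over an interval. -/
def simplexOn (k : ℕ) (a b : ℝ) : Set (Fin k → ℝ) :=
  {t | Monotone t ∧ ∀ i, t i ∈ Set.Icc a b}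

theorem recInt_continuous {A : Type*} [NormedRing A] [NormedAlgebra ℝ A] [CompleteSpace A]
    {ι : Type*} (F : ι → ℝ → A) (L : List ι)
    (hF : ∀ i ∈ L, Continuous (F i)) (b : ℝ) : Continuous fun a => recInt F L a b := by
  induction L with
  | nil => exact continuous_const
  | cons i L ih =>
    have h1 := hF i (by simp)
    have h2 := ih (fun j hj => hF j (by simp [hj]))
    have h3 : Continuous fun t => F i t * recInt F L t b := h1.mul h2
    have : (fun a => recInt F (i :: L) a b) = fun a => - ∫ t in b..a, F i t * recInt F L t b := by
      funext a
      rw [recInt, intervalIntegral.integral_symm]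
    rw [this]
    exact (intervalIntegral.continuous_primitive (fun _ _ => h3.intervalIntegrable _ _) b).neg

theorem recInt_chen {A : Type*} [NormedRing A] [NormedAlgebra ℝ A] [CompleteSpace A]
    {ι : Type*} (F : ι → ℝ → A) (L : List ι)
    (hF : ∀ i ∈ L, Continuous (F i)) (a b c : ℝ) :
    recInt F L a c =
      ∑ n ∈ Finset.range (L.length + 1), recInt F (L.take n) a b * recInt F (L.drop n) b c := by
  induction L generalizing a with
  | nil => simp [recInt]
  | cons i L ih =>
    have h1 := hF i (by simp)
    have hL : ∀ j ∈ L, Continuous (F j) := fun j hj => hF j (by simp [hj])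
    have h3 : Continuous fun t => F i t * recInt F L t c :=
      h1.mul (recInt_continuous F L hL c)
    rw [Finset.sum_range_succ']
    simp only [List.length_cons, List.take_succ_cons, List.drop_succ_cons, List.take_zero,
      List.drop_zero]
    have e1 : recInt F [] a b = (1 : A) := rfl
    rw [e1, one_mul]
    have e2 : recInt F (i :: L) a c = (∫ t in a..b, F i t * recInt F L t c)
        + recInt F (i :: L) b c := by
      simp only [recInt]
      exact (intervalIntegral.integral_add_adjacent_intervals (h3.intervalIntegrable _ _)
        (h3.intervalIntegrable _ _)).symm
    rw [e2]
    congr 1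
    have e3 : ∀ t, F i t * recInt F L t c = ∑ n ∈ Finset.range (L.length + 1),
        F i t * recInt F (L.take n) t b * recInt F (L.drop n) b c := by
      intro t
      rw [ih hL t, Finset.mul_sum]
      simp only [mul_assoc]
    simp only [e3]
    have h4 : ∀ n, Continuous fun t => F i t * recInt F (L.take n) t b := fun n =>
      h1.mul (recInt_continuous F _ (fun j hj => hL j (List.mem_of_mem_take hj)) b)
    rw [intervalIntegral.integral_finsetSum]
    · refine Finset.sum_congr rfl fun n _ => ?_
      rw [recInt]
      have hi := (h4 n).intervalIntegrable (μ := volume) a b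
      simp only [intervalIntegral]
      rw [integral_mul_const_of_integrable hi.1, integral_mul_const_of_integrable hi.2, sub_mul]
    · intro n _
      exact ((h4 n).mul continuous_const).intervalIntegrable _ _

theorem recInt_congr {A : Type*} [NormedRing A] [NormedAlgebra ℝ A]
    {ι : Type*} (F G : ι → ℝ → A) (L : List ι) (a b : ℝ) (hab : a ≤ b)
    (h : ∀ i ∈ L, ∀ t ∈ Set.Icc a b, F i t = G i t) : recInt F L a b = recInt G L a b := by
  induction L generalizing a with
  | nil => rfl
  | cons i L ih =>
    simp only [recInt]
    refine intervalIntegral.integral_congr fun t ht => ?_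
    rw [Set.uIcc_of_le hab] at ht
    rw [h i (by simp) t ht, ih t ht.2 (fun j hj s hs => h j (by simp [hj]) s ⟨ht.1.trans hs.1, hs.2⟩)]

theorem recInt_affine {A : Type*} [NormedRing A] [NormedAlgebra ℝ A]
    {ι : Type*} (F : ι → ℝ → A) (L : List ι) (c d a b : ℝ) :
    recInt (fun i t => c • F i (c * t + d)) L a b = recInt F L (c * a + d) (c * b + d) := by
  induction L generalizing a with
  | nil => rfl
  | cons i L ih =>
    simp only [recInt, ih, smul_mul_assoc]
    rw [intervalIntegral.integral_smul]
    exact intervalIntegral.smul_integral_comp_mul_add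
      (fun x => F i x * recInt F L x (c * b + d)) c d

theorem cons_mem_simplexOn (n : ℕ) (a b x : ℝ) (t : Fin n → ℝ) :
    (Fin.cons x t : Fin (n + 1) → ℝ) ∈ simplexOn (n + 1) a b ↔
      x ∈ Set.Icc a b ∧ t ∈ simplexOn n x b := by
  constructor
  · rintro ⟨hm, hI⟩
    refine ⟨by simpa using hI 0, fun i j hij => ?_, fun i => ⟨?_, ?_⟩⟩
    · simpa using hm (Fin.succ_le_succ_iff.2 hij)
    · simpa using hm (Fin.zero_le i.succ)
    · simpa using (hI i.succ).2
  · rintro ⟨hx, hm, hI⟩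
    refine ⟨fun i j hij => ?_, fun i => ?_⟩
    · induction i using Fin.cases with
      | zero =>
        induction j using Fin.cases with
        | zero => rfl
        | succ j => simpa using (hI j).1
      | succ i =>
        induction j using Fin.cases with
        | zero => exact absurd hij (by simp)
        | succ j => simpa using hm (Fin.succ_le_succ_iff.1 hij)
    · induction i using Fin.cases with
      | zero => simpa using hx
      | succ i => simpa using ⟨hx.1.trans (hI i).1, (hI i).2⟩

theorem isCompact_simplexOn (n : ℕ) (a b : ℝ) : IsCompact (simplexOn n a b) := by
  have hc : IsClosed (simplexOn n a b) := by
    have : simplexOn n a b = (⋂ i, ⋂ j, ⋂ (_ : i ≤ j), {t : Fin n → ℝ | t i ≤ t j}) ∩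
        ⋂ i, {t : Fin n → ℝ | t i ∈ Set.Icc a b} := by
      ext t
      simp [simplexOn, Monotone]
    rw [this]
    refine IsClosed.inter ?_ ?_
    · refine isClosed_iInter fun i => isClosed_iInter fun j => isClosed_iInter fun _ => ?_
      exact isClosed_le (continuous_apply i) (continuous_apply j)
    · exact isClosed_iInter fun i => isClosed_Icc.preimage (continuous_apply i)
  refine IsCompact.of_isClosed_subset (isCompact_Icc (a := fun _ : Fin n => a)
    (b := fun _ => b)) hc fun t ht => ⟨fun i => (ht.2 i).1, fun i => (ht.2 i).2⟩

theorem integral_simplexOn {A : Type*} [NormedRing A] [NormedAlgebra ℝ A] [CompleteSpace A]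
    {ι : Type*} (F : ι → ℝ → A) (L : List ι)
    (hF : ∀ i ∈ L, Continuous (F i)) (a b : ℝ) (hab : a ≤ b) :
    ∫ t in simplexOn L.length a b, (List.ofFn fun i => F (L.get i) (t i)).prod
      = recInt F L a b := by
  induction L generalizing a with
  | nil =>
    have : simplexOn ([] : List ι).length a b = Set.univ := by
      ext t
      simp only [Set.mem_univ, iff_true]
      exact ⟨fun i => i.elim0, fun i => i.elim0⟩
    rw [this]
    have hv : (volume : Measure (Fin ([] : List ι).length → ℝ)) Set.univ = 1 := by
      rw [volume_pi]
      have := Measure.pi_univ (fun _ : Fin ([] : List ι).length => (volume : Measure ℝ))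
      rw [this]
      exact Fin.prod_univ_zero _
    simp only [Measure.restrict_univ]
    change ∫ t : Fin ([] : List ι).length → ℝ, (1 : A) = 1
    rw [integral_const, Measure.real, hv]
    simp
  | cons i L ih =>
    have hL : ∀ j ∈ L, Continuous (F j) := fun j hj => hF j (by simp [hj])
    have hcont : Continuous fun t : Fin (L.length + 1) → ℝ =>
        (List.ofFn fun j => F ((i :: L).get j) (t j)).prod := by
      simp only [List.ofFn_eq_map]
      refine continuous_list_prod _ fun j _ => ?_
      exact (hF _ (List.get_mem _ _)).comp (continuous_apply j)
    have hS := isCompact_simplexOn (L.length + 1) a b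
    have hint := hcont.continuousOn.integrableOn_compact (μ := volume) hS
    have hmp := (volume_preserving_piFinSuccAbove (fun _ : Fin (L.length + 1) => ℝ) 0).symm
    have hsymm : ∀ p : ℝ × (Fin L.length → ℝ),
        (MeasurableEquiv.piFinSuccAbove (fun _ : Fin (L.length + 1) => ℝ) 0).symm p
          = Fin.cons p.1 p.2 := by
      intro p
      simp [MeasurableEquiv.piFinSuccAbove, Fin.insertNthEquiv]
    rw [← integrable_indicator_iff hS.measurableSet] at hint
    change ∫ t in simplexOn (L.length + 1) a b,
      (List.ofFn fun j : Fin (L.length + 1) => F ((i :: L).get j) (t j)).prod = _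
    rw [← integral_indicator hS.measurableSet, ← hmp.integral_comp']
    rw [← hmp.integrable_comp_emb (MeasurableEquiv.measurableEmbedding _)] at hint
    rw [Measure.volume_eq_prod] at hint ⊢
    refine (integral_prod _ hint).trans ?_
    rw [recInt, intervalIntegral.integral_of_le hab,
      ← integral_Icc_eq_integral_Ioc, ← integral_indicator measurableSet_Icc]
    congr 1
    funext x
    simp only [Function.comp_apply]
    by_cases hx : x ∈ Set.Icc a b
    · rw [Set.indicator_of_mem hx, ← ih hL x hx.2]
      have hc : ∀ t : Fin L.length → ℝ, (simplexOn (L.length + 1) a b).indicator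
          (fun t => (List.ofFn fun j : Fin (L.length + 1) => F ((i :: L).get j) (t j)).prod)
          ((MeasurableEquiv.piFinSuccAbove (fun _ : Fin (L.length + 1) => ℝ) 0).symm (x, t))
          = (simplexOn L.length x b).indicator
            (fun t => F i x * (List.ofFn fun j => F (L.get j) (t j)).prod) t := by
        intro t
        rw [hsymm]
        have hiff := cons_mem_simplexOn L.length a b x t
        by_cases ht : t ∈ simplexOn L.length x b
        · rw [Set.indicator_of_mem ht, Set.indicator_of_mem (hiff.2 ⟨hx, ht⟩)]
          rw [List.ofFn_succ, List.prod_cons]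
          rfl
        · rw [Set.indicator_of_notMem ht, Set.indicator_of_notMem (fun h => ht (hiff.1 h).2)]
      refine (integral_congr_ae (Filter.Eventually.of_forall hc)).trans ?_
      have hS' := isCompact_simplexOn L.length x b
      rw [integral_indicator hS'.measurableSet]
      refine integral_const_mul_of_integrable ?_
      refine ContinuousOn.integrableOn_compact hS' (Continuous.continuousOn ?_)
      simp only [List.ofFn_eq_map]
      refine continuous_list_prod _ fun j _ => ?_
      exact (hL _ (List.get_mem _ _)).comp (continuous_apply j)
    · rw [Set.indicator_of_notMem hx]
      refine integral_eq_zero_of_ae (Filter.Eventually.of_forall fun t => ?_)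
      simp only [Pi.zero_apply]
      refine Set.indicator_of_notMem ?_ _
      rw [hsymm, cons_mem_simplexOn]
      exact fun h => hx h.1

/-- The pullback of a form along a path. -/
noncomputable def pullForm (γ : ℝ → E) (w : E → (E →L[ℝ] A)) (t : ℝ) : A :=
  w (γ t) (deriv γ t)

theorem pathIterInt_eq_recInt {E : Type*} [NormedAddCommGroup E] [NormedSpace ℝ E]
    {A : Type*} [NormedRing A] [NormedAlgebra ℝ A] [CompleteSpace A]
    (ω : List (E → (E →L[ℝ] A))) (γ : ℝ → E)
    (h : ∀ w ∈ ω, Continuous (pullForm γ w)) :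
    pathIterInt ω γ = recInt (pullForm γ) ω 0 1 :=
  integral_simplexOn (pullForm γ) ω h 0 1 zero_le_one

theorem pullForm_continuous {E : Type*} [NormedAddCommGroup E] [NormedSpace ℝ E]
    {A : Type*} [NormedRing A] [NormedAlgebra ℝ A]
    (U : Set E) (γ : ℝ → E) (hγ : ContDiff ℝ (⊤ : ℕ∞) γ) (hU : ∀ t, γ t ∈ U)
    (w : E → (E →L[ℝ] A)) (hw : ContDiffOn ℝ (⊤ : ℕ∞) w U) : Continuous (pullForm γ w) := by
  have h1 : Continuous fun t => w (γ t) := hw.continuousOn.comp_continuous hγ.continuous hU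
  have h2 : Continuous (deriv γ) := hγ.continuous_deriv (by simp)
  exact h1.clm_apply h2

/-- Multiplicativity of iterated integrals under composition of 1-paths:
`⟨ω₁⋯ω_k, γ∘δ⟩ = ∑_{i=0}^{k} ⟨ω₁⋯ωᵢ, γ⟩ * ⟨ω_{i+1}⋯ω_k, δ⟩`. -/
theorem pathIterInt_compPath (U : Set E) (hU : IsOpen U)
    (γ δ : ℝ → E) (hγ : IsPathIn U γ) (hδ : IsPathIn U δ) (hmatch : γ 1 = δ 0)
    (ω : List (E → (E →L[ℝ] A))) (hω : ∀ w ∈ ω, ContDiffOn ℝ (⊤ : ℕ∞) w U)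
    (hk : 1 ≤ ω.length) :
    pathIterInt ω (compPath γ δ) =
      ∑ i ∈ Finset.range (ω.length + 1),
        pathIterInt (ω.take i) γ * pathIterInt (ω.drop i) δ := by
  obtain ⟨hγs, hγU, ε, hε, hγ0, hγ1⟩ := hγ
  obtain ⟨hδs, hδU, η, hη, hδ0, hδ1⟩ := hδ
  have hc : compPath γ δ = fun t => γ (2 * t) + δ (2 * t - 1) - γ 1 := by
    funext t
    unfold compPath
    split_ifs with h
    · rw [hδ0 (2 * t - 1) (by linarith), ← hmatch]; simp
    · rw [hγ1 (2 * t) (by linarith)]; simp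
  have hcs : ContDiff ℝ (⊤ : ℕ∞) (compPath γ δ) := by
    rw [hc]; fun_prop
  have hcU : ∀ t, compPath γ δ t ∈ U := by
    intro t
    unfold compPath
    split_ifs
    · exact hγU _
    · exact hδU _
  have hγ' : ∀ t, 1 ≤ t → deriv γ t = 0 := by
    intro t ht
    have : γ =ᶠ[nhds t] fun _ => γ 1 := by
      filter_upwards [lt_mem_nhds (show 1 - ε < t by linarith)] with s hs
      exact hγ1 s hs.le
    rw [this.deriv_eq]; simp
  have hδ' : ∀ t, t ≤ 0 → deriv δ t = 0 := by
    intro t ht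
    have : δ =ᶠ[nhds t] fun _ => δ 0 := by
      filter_upwards [gt_mem_nhds (show t < η by linarith)] with s hs
      exact hδ0 s hs.le
    rw [this.deriv_eq]; simp
  have hd : ∀ t, deriv (compPath γ δ) t
      = (2 : ℝ) • deriv γ (2 * t) + (2 : ℝ) • deriv δ (2 * t - 1) := by
    intro t
    have g1 : HasDerivAt (fun t : ℝ => 2 * t) 2 t := by
      simpa using (hasDerivAt_id t).const_mul (2 : ℝ)
    have g2 : HasDerivAt (fun t : ℝ => 2 * t - 1) 2 t := g1.sub_const 1
    have d1 : HasDerivAt γ (deriv γ (2 * t)) (2 * t) :=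
      (hγs.differentiable (by simp) _).hasDerivAt
    have d2 : HasDerivAt δ (deriv δ (2 * t - 1)) (2 * t - 1) :=
      (hδs.differentiable (by simp) _).hasDerivAt
    rw [hc]
    exact (((d1.scomp t g1).add (d2.scomp t g2)).sub_const (γ 1)).deriv
  have kc : ∀ w ∈ ω, Continuous (pullForm (compPath γ δ) w) := fun w hw =>
    pullForm_continuous U _ hcs hcU w (hω w hw)
  have kγ : ∀ w ∈ ω, Continuous (pullForm γ w) := fun w hw =>
    pullForm_continuous U _ hγs hγU w (hω w hw)
  have kδ : ∀ w ∈ ω, Continuous (pullForm δ w) := fun w hw =>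
    pullForm_continuous U _ hδs hδU w (hω w hw)
  rw [pathIterInt_eq_recInt ω _ kc, recInt_chen _ ω kc 0 (1 / 2) 1]
  refine Finset.sum_congr rfl fun n _ => ?_
  rw [pathIterInt_eq_recInt _ γ fun w hw => kγ w (List.mem_of_mem_take hw),
    pathIterInt_eq_recInt _ δ fun w hw => kδ w (List.mem_of_mem_drop hw)]
  congr 1
  · have h := recInt_affine (pullForm γ) (ω.take n) 2 0 0 (1 / 2)
    norm_num at h
    rw [← h]
    norm_num
    refine recInt_congr _ _ _ _ _ (by norm_num) fun w _ t ht => ?_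
    have ht2 : t ≤ 1 / 2 := ht.2
    have e : compPath γ δ t = γ (2 * t) := by simp only [compPath]; rw [if_pos ht2]
    simp only [pullForm]
    rw [hd, e, hδ' (2 * t - 1) (by linarith)]
    simp
  · have h := recInt_affine (pullForm δ) (ω.drop n) 2 (-1) (1 / 2) 1
    norm_num at h
    rw [← h]
    norm_num
    refine recInt_congr _ _ _ _ _ (by norm_num) fun w _ t ht => ?_
    have ht2 : 1 / 2 ≤ t := by have := ht.1; linarith
    have e : compPath γ δ t = δ (2 * t - 1) := by
      rw [hc]
      simp only
      rw [hγ1 (2 * t) (by linarith)]; simp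
    simp only [pullForm]
    rw [hd, e, hγ' (2 * t) (by linarith)]
    simp [sub_eq_add_neg]
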